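/- arXiv:2510.03173 — 2 statements merged into one kernel-verified Lean document; each statement's English description precedes it below -/
import Mathlib

section
/- Let M be a finitely generated free ℤ-module with a nondegenerate bilinear alternating form ω : M → M → ℤ. Suppose b_1, …, b_k ∈ M are such that the composite of transvections T_{b_k} ∘ ⋯ ∘ T_{b_1} equals the identity of M and at least one b_i is nonzero. Then the submodule of M spanned by b_1, …, b_k has rank at least 2. (Homologically: among the vanishing cycles of a nontrivial Lefschetz fibration whose monodromy factorizes the identity, at least two are nonseparating with distinct, ℤ-linearly independent homology classes.) -/
theorem two_le_finrank_of_alternating_ne_zero {M : Type*} [AddCommGroup M]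
    [Module ℤ M] (ω : M →ₗ[ℤ] M →ₗ[ℤ] ℤ) (halt : ∀ x, ω x x = 0)
    (N : Submodule ℤ M) [Module.Finite ℤ N] {x y : M} (hx : x ∈ N) (hy : y ∈ N)
    (hxy : ω x y ≠ 0) : 2 ≤ Module.finrank ℤ N := by
  have hli : LinearIndependent ℤ ![(⟨x, hx⟩ : N), ⟨y, hy⟩] := by
    rw [LinearIndependent.pair_iff]
    intro s t hst
    have hst' : s • x + t • y = 0 := congrArg Subtype.val hst
    have h₁ : ω (s • x + t • y) y = 0 := by simp [hst']
    have h₂ : ω x (s • x + t • y) = 0 := by simp [hst']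
    simp only [map_add, map_zsmul, LinearMap.add_apply, LinearMap.smul_apply, halt,
      smul_eq_mul, mul_zero, add_zero, zero_add] at h₁ h₂
    exact ⟨(mul_eq_zero.mp h₁).resolve_right hxy, (mul_eq_zero.mp h₂).resolve_right hxy⟩
  simpa using hli.fintype_card_le_finrank

theorem foldl_transvection_of_isotropic {M : Type*} [AddCommGroup M]
    [Module ℤ M] (ω : M →ₗ[ℤ] M →ₗ[ℤ] ℤ) (L : List M)
    (hL : ∀ a ∈ L, ∀ b ∈ L, ω a b = 0) (y : M) :
    L.foldl (fun z b => z + ω z b • b) y = y + (L.map fun b => ω y b • b).sum := by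
  induction L generalizing y with
  | nil => simp
  | cons a L ih =>
    have hcongr : (L.map fun b => ω (y + ω y a • a) b • b) = L.map fun b => ω y b • b := by
      refine List.map_congr_left fun b hb => ?_
      have hab : ω a b = 0 := hL a (by simp) b (by simp [hb])
      simp [hab]
    rw [List.foldl_cons, ih (fun c hc d hd => hL c (by simp [hc]) d (by simp [hd])), hcongr,
      List.map_cons, List.sum_cons, add_assoc]

open TensorProduct in
/-- If a composite of transvections along `b₁, …, b_k` (with respect to a nondegenerate
alternating form on a finitely generated free `ℤ`-module) is the identity and some
`bᵢ` is nonzero, then the span of the `bᵢ` has rank at least `2`. -/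
theorem rank_span_ge_two_of_transvection_comp_eq_id {M : Type*} [AddCommGroup M]
    [Module ℤ M] [Module.Free ℤ M] [Module.Finite ℤ M]
    (ω : M →ₗ[ℤ] M →ₗ[ℤ] ℤ) (halt : ∀ x, ω x x = 0)
    (hnd : ∀ b : M, b ≠ 0 → ∃ a : M, ω a b ≠ 0)
    (k : ℕ) (b : Fin k → M)
    (hid : (List.ofFn (fun i : Fin k => fun y : M => y + ω y (b i) • (b i))).foldl
      (fun z f => f z) = id)
    (hne : ∃ i, b i ≠ 0) :
    2 ≤ Module.finrank ℚ (ℚ ⊗[ℤ] ↥(Submodule.span ℤ (Set.range b))) := by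
  obtain rfl : ‹Module ℤ M› = AddCommGroup.toIntModule M := Subsingleton.elim _ _
  rw [Module.finrank_baseChange]
  by_contra hlt
  have hiso : ∀ i j, ω (b i) (b j) = 0 := fun i j => by
    by_contra hij
    exact hlt (two_le_finrank_of_alternating_ne_zero ω halt _
      (Submodule.subset_span ⟨i, rfl⟩) (Submodule.subset_span ⟨j, rfl⟩) hij)
  obtain ⟨i, hi⟩ := hne
  obtain ⟨x, hx⟩ := hnd _ hi
  have hmap : List.ofFn (fun i : Fin k => fun y : M => y + ω y (b i) • (b i)) =
      (List.ofFn b).map fun c y => y + ω y c • c := by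
    rw [List.map_ofFn]; rfl
  have hfold := congrFun hid x
  rw [hmap, List.foldl_map, foldl_transvection_of_isotropic ω (List.ofFn b) (by
    simpa [List.mem_ofFn] using hiso), id, add_eq_left, List.map_ofFn, List.sum_ofFn] at hfold
  have hsum : ∑ j, ω x (b j) * ω x (b j) = 0 := by
    simpa using congrArg (ω x) hfold
  exact hx (mul_self_eq_zero.mp
    ((Finset.sum_eq_zero_iff_of_nonneg fun j _ => mul_self_nonneg _).mp hsum i
      (Finset.mem_univ i)))
end

section
/- Let g ≥ 1 and let M be a free ℤ-module of rank 2g with a nondegenerate bilinear alternating form ω : M → M → ℤ (e.g. the standard symplectic form on H₁(Σ_g;ℤ) ≅ ℤ^{2g}). Suppose b_1, …, b_k ∈ M are such that the composite of transvections T_{b_k} ∘ ⋯ ∘ T_{b_1} equals the identity of M and at least one b_i is nonzero. Then the quotient module M / span{b_1, …, b_k} has rank at most 2g − 2. (This is the homological content of the theorem that a nontrivial genus-g Lefschetz fibration X → S² satisfies 0 ≤ b₁(X) ≤ 2g − 2, since H₁(X;ℤ) is the quotient of H₁(Σ_g;ℤ) by the classes of the vanishing cycles.) -/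
/-- A composite of transvections along pairwise orthogonal vectors adds up their increments. -/
theorem foldl_transvection_of_pairwise_orthogonal {R M : Type*} [CommRing R] [AddCommGroup M]
    [Module R M] (ω : M →ₗ[R] M →ₗ[R] R) (l : List M) (hl : ∀ c ∈ l, ∀ d ∈ l, ω c d = 0) (x : M) :
    (l.map fun (c y : M) => y + ω y c • c).foldl (fun z f => f z) x =
      x + (l.map fun c => ω x c • c).sum := by
  induction l generalizing x with
  | nil => simp
  | cons c l ih =>
    have hc : ∀ d ∈ l, ω (x + ω x c • c) d = ω x d := fun d hd => by
      simp [hl c (by simp) d (by simp [hd])]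
    have hsum : (l.map fun d => ω (x + ω x c • c) d • d) = l.map fun d => ω x d • d :=
      List.map_congr_left fun d hd => by rw [hc d hd]
    rw [List.map_cons, List.foldl_cons,
      ih (fun d hd e he => hl d (by simp [hd]) e (by simp [he])), hsum]
    simp [add_assoc]

/-- If a composite of transvections along pairwise orthogonal vectors is the identity, then all
these vectors lie in the right kernel of the form. -/
theorem apply_eq_zero_of_foldl_transvection_eq_id {R M : Type*} [CommRing R] [LinearOrder R]
    [IsStrictOrderedRing R] [AddCommGroup M] [Module R M] (ω : M →ₗ[R] M →ₗ[R] R) {k : ℕ}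
    (b : Fin k → M)
    (hid : (List.ofFn (fun i : Fin k => fun y : M => y + ω y (b i) • (b i))).foldl
      (fun z f => f z) = id)
    (horth : ∀ i j, ω (b i) (b j) = 0) (x : M) (i : Fin k) : ω x (b i) = 0 := by
  have hofFn : List.ofFn (fun i : Fin k => fun y : M => y + ω y (b i) • (b i)) =
      (List.ofFn b).map fun (c y : M) => y + ω y c • c := by
    rw [List.map_ofFn]; rfl
  have hx := congrFun hid x
  rw [hofFn, foldl_transvection_of_pairwise_orthogonal ω _
    (by simpa [List.mem_ofFn] using horth), List.map_ofFn, List.sum_ofFn] at hx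
  have hsum : ∑ j, ω x (b j) • b j = 0 := by simpa using hx
  have hsq : ∑ j, ω x (b j) * ω x (b j) = 0 := by
    simpa using congrArg (ω x) hsum
  exact mul_self_eq_zero.mp <|
    (Finset.sum_eq_zero_iff_of_nonneg fun j _ => mul_self_nonneg _).mp hsq i (Finset.mem_univ i)

/-- Two vectors that pair nontrivially under an alternating form are linearly independent. -/
theorem linearIndependent_pair_of_alternating_ne_zero {R M : Type*} [CommRing R] [IsDomain R]
    [AddCommGroup M] [Module R M] (ω : M →ₗ[R] M →ₗ[R] R) (halt : ∀ x, ω x x = 0) {x y : M}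
    (hxy : ω x y ≠ 0) : LinearIndependent R ![x, y] := by
  refine LinearIndependent.pair_iff.mpr fun s t hst => ⟨?_, ?_⟩
  · simpa [halt, hxy] using congrArg (fun z => ω z y) hst
  · simpa [halt, hxy] using congrArg (ω x) hst

open TensorProduct in
/-- If a submodule contains two vectors that pair nontrivially under an alternating form, then
its corank is at most the rank of the ambient module minus two. -/
theorem finrank_tensor_quotient_add_two_le {R K M : Type*} [CommRing R] [IsDomain R]
    [IsNoetherianRing R] [Field K] [Algebra R K] [IsFractionRing R K] [AddCommGroup M]
    [Module R M] [Module.Finite R M]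
    (ω : M →ₗ[R] M →ₗ[R] R) (halt : ∀ x, ω x x = 0) (S : Submodule R M) {x y : M} (hx : x ∈ S)
    (hy : y ∈ S) (hxy : ω x y ≠ 0) :
    Module.finrank K (K ⊗[R] (M ⧸ S)) + 2 ≤ Module.finrank R M := by
  have hind : LinearIndependent R ![(⟨x, hx⟩ : S), ⟨y, hy⟩] :=
    linearIndependent_pair_of_alternating_ne_zero (ω.domRestrict₁₂ S S) (fun z => halt z) hxy
  have hcard : 2 ≤ Module.finrank R S := by
    simpa using hind.fintype_card_le_finrank
  have hbase : Module.finrank K (K ⊗[R] (M ⧸ S)) = Module.finrank R (M ⧸ S) :=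
    (IsLocalization.finrank_eq K (nonZeroDivisors R) le_rfl).trans <|
      IsLocalizedModule.finrank_eq (nonZeroDivisors R) (TensorProduct.mk R K (M ⧸ S) 1) le_rfl
  have hadd := S.finrank_quotient_add_finrank
  omega

open TensorProduct in
/-- If `M` is free of rank `2g` (`g ≥ 1`) with a nondegenerate alternating form, and a
composite of transvections along `b₁, …, b_k` is the identity with some `bᵢ ≠ 0`, then
the quotient `M / span{b₁,…,b_k}` has rank at most `2g - 2`.  This is the homological
content of `b₁(X) ≤ 2g - 2` for a nontrivial genus-`g` Lefschetz fibration. -/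
theorem rank_quotient_le_of_transvection_comp_eq_id {M : Type*} [AddCommGroup M]
    [Module ℤ M] [Module.Free ℤ M] [Module.Finite ℤ M]
    (g : ℕ) (hg : 1 ≤ g) (hrank : Module.finrank ℤ M = 2 * g)
    (ω : M →ₗ[ℤ] M →ₗ[ℤ] ℤ) (halt : ∀ x, ω x x = 0)
    (hnd : ∀ b : M, b ≠ 0 → ∃ a : M, ω a b ≠ 0)
    (k : ℕ) (b : Fin k → M)
    (hid : (List.ofFn (fun i : Fin k => fun y : M => y + ω y (b i) • (b i))).foldl
      (fun z f => f z) = id)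
    (hne : ∃ i, b i ≠ 0) :
    Module.finrank ℚ (ℚ ⊗[ℤ] (M ⧸ Submodule.span ℤ (Set.range b))) ≤ 2 * g - 2 := by
  obtain rfl : ‹Module ℤ M› = AddCommGroup.toIntModule M := Subsingleton.elim _ _
  have hpair : ∃ i j, ω (b i) (b j) ≠ 0 := by
    by_contra! horth
    obtain ⟨i, hi⟩ := hne
    obtain ⟨a, ha⟩ := hnd (b i) hi
    exact ha (apply_eq_zero_of_foldl_transvection_eq_id ω b hid horth a i)
  obtain ⟨i, j, hij⟩ := hpair
  have hle := finrank_tensor_quotient_add_two_le (K := ℚ) ω halt (Submodule.span ℤ (Set.range b))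
    (Submodule.subset_span ⟨i, rfl⟩) (Submodule.subset_span ⟨j, rfl⟩) hij
  rw [hrank] at hle
  exact Nat.le_sub_of_add_le hle
end
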